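/- Assume ‖·‖ is an admissible norm on ℝ³ and let f : M → ℝ³ be an immersed surface with Birkhoff normal field η. Denote by K the Minkowski Gaussian curvature and by K_e the Euclidean Gaussian curvature of M. For a point p ∈ M, the following statements are equivalent: (a) K_e(p) > 0; (b) K(p) > 0; (c) the affine fundamental form h is (positive or negative) definite at p. -/

import Mathlib

/-!
Differential geometry of immersed surfaces in three-dimensional normed
(Minkowski) spaces, following Balestro–Martini–Teixeira.

`E3 = ℝ³` carries its standard Euclidean inner product and, in addition, a
norm `N` which is strictly convex and smooth.  Surfaces are given in a local
parametrization `f : P2 → E3` (an immersion on an open set `U`), endowed with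
a Birkhoff normal field `η`.
-/

noncomputable section

open scoped InnerProductSpace

abbrev E3 := EuclideanSpace ℝ (Fin 3)
abbrev P2 := EuclideanSpace ℝ (Fin 2)

/-- A smooth, strictly convex norm on `ℝ³` (a Minkowski norm). -/
structure MinkowskiNorm3 where
  N : E3 → ℝ
  nonneg : ∀ x, 0 ≤ N x
  eq_zero_iff : ∀ x, N x = 0 ↔ x = 0
  smul_eq : ∀ (c : ℝ) (x : E3), N (c • x) = |c| * N x
  triangle : ∀ x y, N (x + y) ≤ N x + N y
  strict_triangle : ∀ x y : E3, LinearIndependent ℝ ![x, y] → N (x + y) < N x + N y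
  smooth : ContDiffOn ℝ (⊤ : ℕ∞) N {x : E3 | x ≠ 0}

namespace MinkowskiNorm3

/-- Birkhoff orthogonality of a vector `v` to a set (e.g. a plane) `H`:
`‖v + w‖ ≥ ‖v‖` for all `w ∈ H`. -/
def BirkhoffOrth (m : MinkowskiNorm3) (v : E3) (H : Set E3) : Prop :=
  ∀ w ∈ H, m.N v ≤ m.N (v + w)

/-- The (outward) Euclidean Gauss map of the unit sphere `∂B` of the norm,
expressed on ambient space as the normalized gradient of `N`.  Restricted to
`∂B` it is the map `u⁻¹ : ∂B → ∂B_e`, whose inverse is `u : ∂B_e → ∂B`. -/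
def sphereGauss (m : MinkowskiNorm3) (v : E3) : E3 :=
  ‖gradient m.N v‖⁻¹ • gradient m.N v

/-- The differential `du⁻¹` at a point `v ∈ ∂B`, applied to a vector `w`
(its restriction to the tangent plane of `∂B` at `v` is the inverse of
`du_{u⁻¹(v)}`). -/
def duInv (m : MinkowskiNorm3) (v w : E3) : E3 :=
  fderiv ℝ m.sphereGauss v w

/-- Admissibility of the norm: the unit sphere `∂B` has positive Euclidean
Gaussian curvature at every point; equivalently, the second fundamental form
of `∂B` with respect to the outward normal is positive definite, i.e.
`⟪du⁻¹ w, w⟫ > 0` for every nonzero vector `w` tangent to `∂B`. -/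
def Admissible (m : MinkowskiNorm3) : Prop :=
  ∀ v : E3, m.N v = 1 → ∀ w : E3, w ≠ 0 → fderiv ℝ m.N v w = 0 →
    0 < ⟪m.duInv v w, w⟫_ℝ

end MinkowskiNorm3

/-- An immersed surface (in a local parametrization on an open set `U ⊆ ℝ²`)
in the Minkowski space `(ℝ³, m)`, endowed with a Birkhoff normal vector
field `η`: a smooth unit field with `η(p) ⊣_B T_pM` for all `p`. -/
structure BSurface (m : MinkowskiNorm3) where
  U : Set P2
  isOpen : IsOpen U
  f : P2 → E3
  smooth_f : ContDiffOn ℝ (⊤ : ℕ∞) f U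
  immersion : ∀ p ∈ U, Function.Injective (fderiv ℝ f p)
  η : P2 → E3
  smooth_η : ContDiffOn ℝ (⊤ : ℕ∞) η U
  unit_η : ∀ p ∈ U, m.N (η p) = 1
  birkhoff : ∀ p ∈ U, m.BirkhoffOrth (η p) (Set.range (fderiv ℝ f p))

namespace BSurface

variable {m : MinkowskiNorm3}

/-- The tangent plane `T_pM`, identified (via the push-forward `df_p`) with a
linear plane in ambient `ℝ³`. -/
def tangent (S : BSurface m) (p : P2) : Set E3 := Set.range (fderiv ℝ S.f p)

/-- `h : P2 → P2 → ℝ` (in the parameter coordinates, i.e. `h v w` stands for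
`h(df_p v, df_p w)`) is the affine fundamental form of the immersion at `p`,
determined by the Gauss formula `D_X Y = ∇_X Y + h(X,Y) η`: for coordinate
directions `v, w`, the second derivative `D_v D_w f` minus `h v w • η p` is
tangential. -/
def IsAffineFundForm (S : BSurface m) (p : P2) (h : P2 → P2 → ℝ) : Prop :=
  ∀ v w : P2,
    fderiv ℝ (fun q => fderiv ℝ S.f q w) p v - h v w • S.η p ∈ S.tangent p

end BSurface

/-- The Minkowski normal curvature of the surface parametrized by `f` with
Birkhoff normal field `η`, at `p`, in the tangent direction `X = df_p v`:
`k_{M,p}(X) = ⟪du⁻¹_{η(p)} X, dη_p X⟫ / ⟪du⁻¹_{η(p)} X, X⟫`, using the natural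
identification of the parallel planes `T_pM ≅ T_{η(p)}∂B ≅ T_{ξ(p)}∂B_e`. -/
def normalCurv (m : MinkowskiNorm3) (f η : P2 → E3) (p v : P2) : ℝ :=
  ⟪m.duInv (η p) (fderiv ℝ f p v), fderiv ℝ η p v⟫_ℝ /
    ⟪m.duInv (η p) (fderiv ℝ f p v), fderiv ℝ f p v⟫_ℝ

open Filter Topology

/-- Let a nonzero multiple of a symmetric bilinear form `β` on a plane be diagonalised by a basis,
relative to a positive bilinear form `Q` (not assumed symmetric). Then `β` is definite iff the
product of the eigenvalues is positive. -/
theorem mul_eigenvalues_pos_iff_definite {V : Type*} [AddCommGroup V] [Module ℝ V]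
    (hV : Module.finrank ℝ V = 2) (β Q : LinearMap.BilinForm ℝ V)
    (hsymm : ∀ v w, β v w = β w v) (hQ : ∀ v, v ≠ 0 → 0 < Q v v)
    {c l₁ l₂ : ℝ} (hc : c ≠ 0) {v₁ v₂ : V} (hv : LinearIndependent ℝ ![v₁, v₂])
    (h₁ : ∀ w, c * β v₁ w = l₁ * Q v₁ w) (h₂ : ∀ w, c * β v₂ w = l₂ * Q v₂ w) :
    0 < l₁ * l₂ ↔ (∀ v, v ≠ 0 → 0 < β v v) ∨ (∀ v, v ≠ 0 → β v v < 0) := by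
  have hv₁ : v₁ ≠ 0 := hv.ne_zero 0
  have hv₂ : v₂ ≠ 0 := hv.ne_zero 1
  have ha := hQ v₁ hv₁
  have hd := hQ v₂ hv₂
  have hc2 : 0 < c ^ 2 := by positivity
  have h11 := h₁ v₁
  have h12 := h₁ v₂
  have h21 := h₂ v₁
  have h22 := h₂ v₂
  have hprod : c ^ 2 * (β v₁ v₁ * β v₂ v₂) = (l₁ * l₂) * (Q v₁ v₁ * Q v₂ v₂) := by
    linear_combination (c * β v₂ v₂) * h11 + (l₁ * Q v₁ v₁) * h22
  constructor
  · intro hl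
    have hdetQ : 0 < Q v₁ v₁ * Q v₂ v₂ - Q v₁ v₂ * Q v₂ v₁ := by
      have hne : (-(Q v₁ v₂ + Q v₂ v₁)) • v₁ + (2 * Q v₁ v₁) • v₂ ≠ 0 := fun h0 => by
        have := (LinearIndependent.pair_iff.1 hv _ _ h0).2
        linarith
      have := hQ _ hne
      simp only [map_add, map_smul, LinearMap.add_apply, LinearMap.smul_apply, smul_eq_mul] at this
      have h4 : 0 < Q v₁ v₁ * (4 * (Q v₁ v₁ * Q v₂ v₂) - (Q v₁ v₂ + Q v₂ v₁) ^ 2) := by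
        linarith
      have := pos_of_mul_pos_right h4 ha.le
      nlinarith [sq_nonneg (Q v₁ v₂ - Q v₂ v₁)]
    have hdet : 0 < β v₁ v₁ * β v₂ v₂ - β v₁ v₂ ^ 2 := by
      refine pos_of_mul_pos_right (a := c ^ 2) ?_ hc2.le
      have : c ^ 2 * (β v₁ v₁ * β v₂ v₂ - β v₁ v₂ ^ 2)
          = (l₁ * l₂) * (Q v₁ v₁ * Q v₂ v₂ - Q v₁ v₂ * Q v₂ v₁) := by
        rw [hsymm v₂ v₁] at h21
        linear_combination hprod - (c * β v₁ v₂) * h12 - (l₁ * Q v₁ v₂) * h21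
      rw [this]
      positivity
    have hsq : ∀ v, v ≠ 0 → 0 < β v₁ v₁ * β v v := fun v hv0 => by
      have : FiniteDimensional ℝ V := .of_finrank_pos (by omega)
      have hspan := hv.span_eq_top_of_card_eq_finrank' (by simp [hV])
      have hmem : v ∈ Submodule.span ℝ (Set.range ![v₁, v₂]) := hspan ▸ Submodule.mem_top
      rw [Matrix.range_cons, Matrix.range_cons, Matrix.range_empty, Set.union_empty,
        Set.singleton_union, Submodule.mem_span_pair] at hmem
      obtain ⟨x, y, rfl⟩ := hmem
      have key : β v₁ v₁ * β (x • v₁ + y • v₂) (x • v₁ + y • v₂)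
          = (β v₁ v₁ * x + β v₁ v₂ * y) ^ 2 + (β v₁ v₁ * β v₂ v₂ - β v₁ v₂ ^ 2) * y ^ 2 := by
        simp only [map_add, map_smul, LinearMap.add_apply, LinearMap.smul_apply, smul_eq_mul,
          hsymm v₂ v₁]
        ring
      rw [key]
      by_cases hy : y = 0
      · have hx : x ≠ 0 := by
          rintro rfl
          simp [hy] at hv0
        have h0 : β v₁ v₁ ≠ 0 := fun h0 => by
          rw [h0] at hdet
          nlinarith [sq_nonneg (β v₁ v₂)]
        subst hy
        have : β v₁ v₁ * x ≠ 0 := mul_ne_zero h0 hx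
        simp only [mul_zero, add_zero]
        positivity
      · positivity
    have h0 := hsq v₁ hv₁
    rcases lt_or_ge 0 (β v₁ v₁) with h | h
    · exact Or.inl fun v hv0 => pos_of_mul_pos_right (hsq v hv0) h.le
    · exact Or.inr fun v hv0 => neg_of_mul_pos_right (hsq v hv0) h
  · intro hdef
    have hβ : 0 < β v₁ v₁ * β v₂ v₂ := by
      rcases hdef with h | h
      · exact mul_pos (h _ hv₁) (h _ hv₂)
      · exact mul_pos_of_neg_of_neg (h _ hv₁) (h _ hv₂)
    exact pos_of_mul_pos_left (hprod ▸ mul_pos hc2 hβ) (by positivity)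

namespace MinkowskiNorm3

variable (m : MinkowskiNorm3)

theorem contDiffAt {v : E3} (hv : v ≠ 0) : ContDiffAt ℝ (⊤ : ℕ∞) m.N v :=
  m.smooth.contDiffAt (isOpen_ne.mem_nhds hv)

theorem differentiableAt {v : E3} (hv : v ≠ 0) : DifferentiableAt ℝ m.N v :=
  (m.contDiffAt hv).differentiableAt (by simp)

theorem ne_zero_of_unit {v : E3} (hv : m.N v = 1) : v ≠ 0 := by
  rintro rfl
  rw [(m.eq_zero_iff 0).2 rfl] at hv
  exact zero_ne_one hv

/-- Euler's identity for the norm, which is homogeneous of degree one. -/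
theorem fderiv_self {v : E3} (hv : v ≠ 0) : fderiv ℝ m.N v v = m.N v := by
  have h₁ : HasDerivAt (fun t : ℝ => m.N (t • v)) (fderiv ℝ m.N v v) 1 := by
    have hd : HasFDerivAt m.N (fderiv ℝ m.N v) ((1 : ℝ) • v) := by
      simpa using (m.differentiableAt hv).hasFDerivAt
    have hv' : HasDerivAt (fun t : ℝ => t • v) v 1 := by
      simpa using (hasDerivAt_id (1 : ℝ)).smul_const v
    exact hd.comp_hasDerivAt 1 hv'
  have h₂ : HasDerivAt (fun t : ℝ => m.N (t • v)) (m.N v) 1 := by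
    have hid : HasDerivAt (fun t : ℝ => t * m.N v) (m.N v) 1 := by
      simpa using (hasDerivAt_id (1 : ℝ)).mul_const (m.N v)
    refine hid.congr_of_eventuallyEq ?_
    filter_upwards [lt_mem_nhds (zero_lt_one (α := ℝ))] with t ht
    rw [m.smul_eq, abs_of_pos ht]
  exact h₁.unique h₂

theorem inner_gradient {v w : E3} : ⟪gradient m.N v, w⟫_ℝ = fderiv ℝ m.N v w := by
  simp [gradient]

theorem gradient_ne_zero {v : E3} (hv : v ≠ 0) : gradient m.N v ≠ 0 := fun h0 => by
  have h := m.fderiv_self hv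
  rw [← inner_gradient, h0, inner_zero_left] at h
  exact hv ((m.eq_zero_iff v).1 h.symm)

theorem differentiableAt_sphereGauss {v : E3} (hv : v ≠ 0) :
    DifferentiableAt ℝ m.sphereGauss v := by
  have hg : DifferentiableAt ℝ (gradient m.N) v := by
    have hd : DifferentiableAt ℝ (fderiv ℝ m.N) v :=
      ((m.contDiffAt hv).fderiv_right (m := 1) (by norm_cast)).differentiableAt (by simp)
    exact (InnerProductSpace.toDual ℝ E3).symm.toContinuousLinearEquiv.differentiableAt.comp v hd
  exact ((hg.norm ℝ (m.gradient_ne_zero hv)).inv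
    (norm_ne_zero_iff.2 (m.gradient_ne_zero hv))).smul hg

theorem inner_sphereGauss {v w : E3} :
    ⟪m.sphereGauss v, w⟫_ℝ = ‖gradient m.N v‖⁻¹ * fderiv ℝ m.N v w := by
  rw [sphereGauss, real_inner_smul_left, inner_gradient]

/-- A nonzero vector that is Birkhoff orthogonal to the range of a linear map has that range in the
kernel of the derivative of the norm. -/
theorem BirkhoffOrth.fderiv_eq_zero {m : MinkowskiNorm3} {V : Type*} [NormedAddCommGroup V]
    [NormedSpace ℝ V] {v : E3} (hv : v ≠ 0) {A : V →L[ℝ] E3}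
    (h : m.BirkhoffOrth v (Set.range A)) (z : V) : fderiv ℝ m.N v (A z) = 0 := by
  have hmin : IsLocalMin (fun y => m.N (v + A y)) 0 :=
    Eventually.of_forall fun y => by simpa using h (A y) ⟨y, rfl⟩
  have hd : HasFDerivAt m.N (fderiv ℝ m.N v) (v + A 0) := by
    simpa using (m.differentiableAt hv).hasFDerivAt
  have := hmin.hasFDerivAt_eq_zero (hd.comp (0 : V) (A.hasFDerivAt.const_add v))
  exact DFunLike.congr_fun this z

end MinkowskiNorm3

namespace BSurface

variable {m : MinkowskiNorm3} (S : BSurface m) {p : P2}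

theorem contDiffAt_f (hp : p ∈ S.U) : ContDiffAt ℝ (⊤ : ℕ∞) S.f p :=
  S.smooth_f.contDiffAt (S.isOpen.mem_nhds hp)

theorem differentiableAt_fderiv_f (hp : p ∈ S.U) : DifferentiableAt ℝ (fderiv ℝ S.f) p :=
  ((S.contDiffAt_f hp).fderiv_right (m := 1) (by norm_cast)).differentiableAt (by simp)

theorem fderiv_fderiv_apply (hp : p ∈ S.U) (v w : P2) :
    fderiv ℝ (fun q => fderiv ℝ S.f q w) p v = fderiv ℝ (fderiv ℝ S.f) p v w := by
  rw [fderiv_clm_apply (S.differentiableAt_fderiv_f hp) (differentiableAt_const w)]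
  simp

theorem η_ne_zero (hp : p ∈ S.U) : S.η p ≠ 0 := m.ne_zero_of_unit (S.unit_η p hp)

theorem fderiv_norm_tangent (hp : p ∈ S.U) (z : P2) :
    fderiv ℝ m.N (S.η p) (fderiv ℝ S.f p z) = 0 :=
  (S.birkhoff p hp).fderiv_eq_zero (S.η_ne_zero hp) z

/-- The Weingarten equation for a field normal to the surface in the Euclidean sense. -/
theorem inner_fderiv_normal (hp : p ∈ S.U) {ζ : P2 → E3} (hζ : DifferentiableAt ℝ ζ p)
    (hperp : ∀ q ∈ S.U, ∀ z : P2, ⟪ζ q, fderiv ℝ S.f q z⟫_ℝ = 0) (v w : P2) :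
    ⟪fderiv ℝ ζ p v, fderiv ℝ S.f p w⟫_ℝ = -⟪ζ p, fderiv ℝ (fderiv ℝ S.f) p v w⟫_ℝ := by
  have hw : DifferentiableAt ℝ (fun q => fderiv ℝ S.f q w) p :=
    (S.differentiableAt_fderiv_f hp).clm_apply (differentiableAt_const w)
  have h := fderiv_inner_apply ℝ hζ hw v
  have h0 : (fun q => ⟪ζ q, fderiv ℝ S.f q w⟫_ℝ) =ᶠ[𝓝 p] fun _ => 0 := by
    filter_upwards [S.isOpen.mem_nhds hp] with q hq using hperp q hq w
  rw [h0.fderiv_eq, fderiv_fderiv_apply S hp] at h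
  simp at h
  linarith

theorem inner_fderiv_fderiv {h : P2 → P2 → ℝ} (hh : S.IsAffineFundForm p h) (hp : p ∈ S.U)
    {n : E3} (hn : ∀ z, ⟪n, fderiv ℝ S.f p z⟫_ℝ = 0) (v w : P2) :
    ⟪n, fderiv ℝ (fderiv ℝ S.f) p v w⟫_ℝ = h v w * ⟪n, S.η p⟫_ℝ := by
  obtain ⟨z, hz⟩ := hh v w
  have := hn z
  rw [hz, fderiv_fderiv_apply S hp, inner_sub_right, real_inner_smul_right] at this
  linarith

/-- A nonzero Euclidean normal vector is not Euclidean orthogonal to the Birkhoff normal. -/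
theorem inner_η_ne_zero (hp : p ∈ S.U) {n : E3} (hn0 : n ≠ 0)
    (hn : ∀ z, ⟪n, fderiv ℝ S.f p z⟫_ℝ = 0) : ⟪n, S.η p⟫_ℝ ≠ 0 := by
  let T := LinearMap.range (fderiv ℝ S.f p).toLinearMap
  have hT : Module.finrank ℝ T = 2 := by
    rw [LinearMap.finrank_range_of_inj (S.immersion p hp)]
    simp
  have hT' : Module.finrank ℝ Tᗮ = 1 := by
    have := T.finrank_add_finrank_orthogonal
    rw [hT, finrank_euclideanSpace_fin] at this
    omega
  have mem : ∀ x : E3, (∀ z, ⟪x, fderiv ℝ S.f p z⟫_ℝ = 0) → x ∈ Tᗮ := fun x hx => by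
    rw [Submodule.mem_orthogonal']
    rintro _ ⟨z, rfl⟩
    exact hx z
  let g : Tᗮ := ⟨gradient m.N (S.η p), mem _ fun z => by
    rw [m.inner_gradient, S.fderiv_norm_tangent hp]⟩
  have hg : g ≠ 0 := fun h0 =>
    m.gradient_ne_zero (S.η_ne_zero hp) (congrArg Subtype.val h0)
  obtain ⟨t, ht⟩ := (finrank_eq_one_iff_of_nonzero' g hg).1 hT' ⟨n, mem n hn⟩
  have ht' : t • gradient m.N (S.η p) = n := congrArg Subtype.val ht
  rw [← ht', real_inner_smul_left, m.inner_gradient, m.fderiv_self (S.η_ne_zero hp),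
    S.unit_η p hp, mul_one]
  rintro rfl
  exact hn0 (by simpa using ht'.symm)

end BSurface

/-- For an admissible norm, at any `p ∈ M` the following are
equivalent: (a) the Euclidean Gaussian curvature `K_e(p) = μ₁ μ₂` is positive;
(b) the Minkowski Gaussian curvature `K(p) = λ₁ λ₂` is positive; (c) the
affine fundamental form `h` is (positive or negative) definite at `p`. -/
theorem gaussian_curvature_positivity (m : MinkowskiNorm3) (hadm : m.Admissible)
    (S : BSurface m) (p : P2) (hp : p ∈ S.U)
    (ξ : P2 → E3) (hξsmooth : ContDiffOn ℝ (⊤ : ℕ∞) ξ S.U)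
    (hξunit : ∀ q ∈ S.U, ‖ξ q‖ = 1)
    (hξperp : ∀ q ∈ S.U, ∀ z : P2, ⟪ξ q, fderiv ℝ S.f q z⟫_ℝ = 0)
    (h : P2 → P2 → ℝ) (hh : S.IsAffineFundForm p h)
    (lam₁ lam₂ : ℝ)
    (hM : ∃ v₁ v₂ : P2, LinearIndependent ℝ ![v₁, v₂] ∧
      fderiv ℝ S.η p v₁ = lam₁ • fderiv ℝ S.f p v₁ ∧
      fderiv ℝ S.η p v₂ = lam₂ • fderiv ℝ S.f p v₂)
    (mu₁ mu₂ : ℝ)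
    (hE : ∃ u₁ u₂ : P2, LinearIndependent ℝ ![u₁, u₂] ∧
      fderiv ℝ ξ p u₁ = mu₁ • fderiv ℝ S.f p u₁ ∧
      fderiv ℝ ξ p u₂ = mu₂ • fderiv ℝ S.f p u₂) :
    ((0 < mu₁ * mu₂) ↔ (0 < lam₁ * lam₂)) ∧
    ((0 < mu₁ * mu₂) ↔
      ((∀ v : P2, v ≠ 0 → 0 < h v v) ∨ (∀ v : P2, v ≠ 0 → h v v < 0))) := by
  obtain ⟨v₁, v₂, hv, hv₁, hv₂⟩ := hM
  obtain ⟨u₁, u₂, hu, hu₁, hu₂⟩ := hE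
  have hη0 := S.η_ne_zero hp
  have hA : ∀ v : P2, v ≠ 0 → fderiv ℝ S.f p v ≠ 0 := fun v hv0 =>
    (map_ne_zero_iff _ (S.immersion p hp)).2 hv0
  let A := (fderiv ℝ S.f p).toLinearMap
  let β : LinearMap.BilinForm ℝ P2 := LinearMap.mk₂ ℝ
    (fun v w => ⟪gradient m.N (S.η p), fderiv ℝ (fderiv ℝ S.f) p v w⟫_ℝ)
    (fun _ _ _ => by simp [inner_add_right]) (fun _ _ _ => by simp)
    (fun _ _ _ => by simp [inner_add_right]) (fun _ _ _ => by simp)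
  have hβ : ∀ v w, h v w = β v w := fun v w => by
    have := S.inner_fderiv_fderiv hh hp (n := gradient m.N (S.η p))
      (fun z => by rw [m.inner_gradient, S.fderiv_norm_tangent hp]) v w
    rw [m.inner_gradient (w := S.η p), m.fderiv_self hη0, S.unit_η p hp, mul_one] at this
    exact this.symm
  have hsymm : ∀ v w, β v w = β w v := fun v w => by
    have := (S.contDiffAt_f hp).isSymmSndFDerivAt (by simp; norm_cast) v w
    simp only [β, LinearMap.mk₂_apply, this]
  have hweingarten : ∀ {ζ : P2 → E3}, DifferentiableAt ℝ ζ p →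
      (∀ q ∈ S.U, ∀ z : P2, ⟪ζ q, fderiv ℝ S.f q z⟫_ℝ = 0) → ∀ v w,
      -⟪ζ p, S.η p⟫_ℝ * β v w = ⟪fderiv ℝ ζ p v, fderiv ℝ S.f p w⟫_ℝ := fun hζ hperp v w => by
    rw [S.inner_fderiv_normal hp hζ hperp, S.inner_fderiv_fderiv hh hp (hperp p hp), hβ]
    ring
  have hmu := mul_eigenvalues_pos_iff_definite (by simp) β ((innerₗ E3).compl₁₂ A A) hsymm
    (fun v hv0 => real_inner_self_pos.2 (hA v hv0))
    (neg_ne_zero.2 (S.inner_η_ne_zero hp (n := ξ p)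
      (norm_ne_zero_iff.1 (by simp [hξunit p hp])) (hξperp p hp))) hu
    (l₁ := mu₁) (l₂ := mu₂)
    (fun w => by
      rw [hweingarten ((hξsmooth.contDiffAt (S.isOpen.mem_nhds hp)).differentiableAt (by simp))
        hξperp, hu₁, real_inner_smul_left]
      rfl)
    (fun w => by
      rw [hweingarten ((hξsmooth.contDiffAt (S.isOpen.mem_nhds hp)).differentiableAt (by simp))
        hξperp, hu₂, real_inner_smul_left]
      rfl)
  have hη : DifferentiableAt ℝ S.η p :=
    (S.smooth_η.contDiffAt (S.isOpen.mem_nhds hp)).differentiableAt (by simp)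
  have hG := m.differentiableAt_sphereGauss hη0
  have hGη : ∀ v, fderiv ℝ (m.sphereGauss ∘ S.η) p v = m.duInv (S.η p) (fderiv ℝ S.η p v) :=
    fun v => by rw [fderiv_comp p hG hη]; rfl
  have hGperp : ∀ q ∈ S.U, ∀ z : P2, ⟪(m.sphereGauss ∘ S.η) q, fderiv ℝ S.f q z⟫_ℝ = 0 :=
    fun q hq z => by
      rw [Function.comp_apply, m.inner_sphereGauss, S.fderiv_norm_tangent hq, mul_zero]
  have hGne : (m.sphereGauss ∘ S.η) p ≠ 0 :=
    have hg := m.gradient_ne_zero hη0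
    smul_ne_zero (inv_ne_zero (norm_ne_zero_iff.2 hg)) hg
  have hlam := mul_eigenvalues_pos_iff_definite (by simp) β
    ((innerₗ E3).compl₁₂ ((fderiv ℝ m.sphereGauss (S.η p)).toLinearMap ∘ₗ A) A) hsymm
    (fun v hv0 => hadm _ (S.unit_η p hp) _ (hA v hv0) (S.fderiv_norm_tangent hp v))
    (neg_ne_zero.2 (S.inner_η_ne_zero hp hGne (hGperp p hp))) hv (l₁ := lam₁) (l₂ := lam₂)
    (fun w => by
      rw [hweingarten (hG.comp p hη) hGperp, hGη, hv₁, MinkowskiNorm3.duInv, map_smul,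
        real_inner_smul_left]
      rfl)
    (fun w => by
      rw [hweingarten (hG.comp p hη) hGperp, hGη, hv₂, MinkowskiNorm3.duInv, map_smul,
        real_inner_smul_left]
      rfl)
  simp only [hβ]
  exact ⟨hmu.trans hlam.symm, hmu⟩
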